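/- arXiv:2505.05807 — 3 statements merged into one kernel-verified Lean document; each statement's English description precedes it below -/
import Mathlib

section
/- Let T be a tree on n vertices and u, v distinct non-adjacent vertices of T. Form the shadow graph by replacing each of u, v with an edge (u₁u₂ and v₁v₂), joining each uᵢ to all neighbors of u and each vⱼ to all neighbors of v. Then the number of proper k-colorings of this shadow graph equals k·(k-1)^{n-deg(u)-deg(v)+1}·(k-2)^{deg(u)+deg(v)}. -/
/-- The number of proper `k`-colorings of a simple graph `G`. -/
noncomputable def numColorings {V : Type} (G : SimpleGraph V) (k : ℕ) : ℕ :=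
  Nat.card {f : V → Fin k // ∀ u w, G.Adj u w → f u ≠ f w}

/-- The shadow graph `G_S`: each `v ∈ S` is replaced by an adjacent pair `v₁, v₂`, both
joined to all neighbors of `v` not in `S`, and for every edge of `G` with both endpoints
in `S` all four edges between the corresponding pairs are added. -/
def multiShadow {V : Type} (G : SimpleGraph V) (S : Finset V) :
    SimpleGraph ({u : V // u ∉ S} ⊕ ({u : V // u ∈ S} × Bool)) :=
  SimpleGraph.fromRel (fun x y =>
    match x, y with
    | Sum.inl a, Sum.inl b => G.Adj a.1 b.1
    | Sum.inl a, Sum.inr (w, _) => G.Adj a.1 w.1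
    | Sum.inr _, Sum.inl _ => False
    | Sum.inr (w, _), Sum.inr (x, _) => w = x ∨ G.Adj w.1 x.1)

def SGood {V : Type} (k : ℕ) (S : Set V) (x : V) (c : Fin k × Fin k) : Prop := c.1 ≠ c.2 ↔ x ∈ S
def SDis {k : ℕ} (c d : Fin k × Fin k) : Prop := c.1 ≠ d.1 ∧ c.1 ≠ d.2 ∧ c.2 ≠ d.1 ∧ c.2 ≠ d.2

lemma SDis.symm {k : ℕ} {c d : Fin k × Fin k} (h : SDis c d) : SDis d c := by
  obtain ⟨a, b, e, f⟩ := h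
  exact ⟨a.symm, e.symm, b.symm, f.symm⟩

noncomputable def scount {V : Type} (T : SimpleGraph V) (S : Set V) (k : ℕ) : ℕ :=
  Nat.card {f : V → Fin k × Fin k // (∀ x, SGood k S x (f x)) ∧ ∀ x y, T.Adj x y → SDis (f x) (f y)}

lemma shadow_eq_scount {V : Type} [DecidableEq V] (T : SimpleGraph V) (S : Finset V) (k : ℕ) :
    numColorings (multiShadow T S) k = scount T (S : Set V) k := by
  unfold numColorings scount
  refine Nat.card_congr
    { toFun := fun f => ⟨fun x => if h : x ∈ S then (f.1 (.inr (⟨x, h⟩, false)), f.1 (.inr (⟨x, h⟩, true)))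
        else (f.1 (.inl ⟨x, h⟩), f.1 (.inl ⟨x, h⟩)), ?_, ?_⟩
      invFun := fun g => ⟨fun z => match z with
        | .inl a => (g.1 a.1).1
        | .inr (w, b) => if b then (g.1 w.1).2 else (g.1 w.1).1, ?_⟩
      left_inv := ?_
      right_inv := ?_ }
  · intro x
    obtain ⟨f, hf⟩ := f
    by_cases h : x ∈ S
    · simp only [SGood, h, dite_true]
      have := hf (.inr (⟨x, h⟩, false)) (.inr (⟨x, h⟩, true)) (by simp [multiShadow])
      simpa [h] using this
    · simp [SGood, h]
  · intro x y hxy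
    obtain ⟨f, hf⟩ := f
    have hne := hxy.ne
    by_cases hx : x ∈ S <;> by_cases hy : y ∈ S <;> simp only [hx, hy, dite_true, dite_false] <;>
      refine ⟨?_, ?_, ?_, ?_⟩ <;> apply hf <;> simp [multiShadow, hxy, hxy.symm, hne]
  · obtain ⟨g, hg, hg2⟩ := g
    have hs : ∀ (w : {u // u ∈ S}), (g w.1).1 ≠ (g w.1).2 := fun w => (hg w.1).2 (by simp)
    rintro (⟨a, ha⟩ | ⟨⟨a, ha⟩, b⟩) (⟨c, hc⟩ | ⟨⟨c, hc⟩, d⟩) h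
    · simp only [multiShadow, SimpleGraph.fromRel_adj] at h
      exact (hg2 a c (h.2.elim id (fun h => h.symm))).1
    · simp only [multiShadow, SimpleGraph.fromRel_adj, or_false] at h
      have := hg2 a c h.2
      cases d <;> simp [this.1, this.2.1]
    · simp only [multiShadow, SimpleGraph.fromRel_adj, false_or] at h
      have := hg2 a c h.2.symm
      cases b <;> simp [this.1, this.2.2.1]
    · simp only [multiShadow, SimpleGraph.fromRel_adj] at h
      obtain ⟨h1, h2⟩ := h
      by_cases hac : a = c
      · subst hac
        have := hs ⟨a, ha⟩
        cases b <;> cases d <;> simp_all [Ne.symm this]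
      · have hadj : T.Adj a c := by
          simp only [Subtype.mk.injEq, hac, Ne.symm hac, false_or] at h2
          exact h2.elim id (fun h => h.symm)
        obtain ⟨p, q, r, s⟩ := hg2 a c hadj
        cases b <;> cases d <;> simp [p, q, r, s]
  · rintro ⟨f, hf⟩
    ext1
    funext z
    rcases z with ⟨a, ha⟩ | ⟨⟨a, ha⟩, b⟩
    · simp [ha]
    · cases b <;> simp [ha]
  · rintro ⟨g, hg, hg2⟩
    ext1
    funext x
    by_cases h : x ∈ S
    · simp [h]
    · have : (g x).1 = (g x).2 := by
        by_contra hc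
        exact h (by simpa using (hg x).1 hc)
      simp only [h, dite_false]
      exact Prod.ext rfl this

/-- number of admissible colour objects at a leaf -/
lemma card_NN {k : ℕ} (a : Fin k × Fin k) (h : a.1 = a.2) :
    Nat.card {c : Fin k × Fin k // c.1 = c.2 ∧ SDis c a} = k - 1 := by
  classical
  rw [Nat.card_congr (β := {c : Fin k // c ≠ a.1})
    { toFun := fun c => ⟨c.1.1, c.2.2.1⟩
      invFun := fun c => ⟨(c.1, c.1), rfl, c.2, h ▸ c.2, c.2, h ▸ c.2⟩
      left_inv := fun c => by ext <;> simp [c.2.1]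
      right_inv := fun c => rfl }]
  rw [Nat.card_eq_fintype_card, Fintype.card_subtype_compl]
  simp

lemma card_SN {k : ℕ} (a : Fin k × Fin k) (h : a.1 ≠ a.2) :
    Nat.card {c : Fin k × Fin k // c.1 = c.2 ∧ SDis c a} = k - 2 := by
  classical
  have hc : ∀ c : {c : Fin k // c ∈ (({a.1, a.2} : Finset (Fin k))ᶜ)}, SDis (c.1, c.1) a := by
    intro c
    have := c.2
    simp at this
    simp [SDis, this]
  rw [Nat.card_congr (β := {c : Fin k // c ∈ (({a.1, a.2} : Finset (Fin k))ᶜ)})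
    { toFun := fun c => ⟨c.1.1, by simp [c.2.2.1, c.2.2.2.1]⟩
      invFun := fun c => ⟨(c.1, c.1), rfl, hc c⟩
      left_inv := fun c => by ext <;> simp [c.2.1]
      right_inv := fun c => rfl }]
  rw [Nat.card_eq_fintype_card, Fintype.card_coe, Finset.card_compl, Finset.card_pair h]
  simp

lemma card_NS {k : ℕ} (a : Fin k × Fin k) (h : a.1 = a.2) :
    Nat.card {c : Fin k × Fin k // c.1 ≠ c.2 ∧ SDis c a} = (k - 1) * (k - 2) := by
  classical
  rw [Nat.card_congr (β := {c : Fin k × Fin k // c ∈ (({a.1} : Finset (Fin k))ᶜ).offDiag})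
    (Equiv.subtypeEquivRight (fun c => by simp [SDis, ← h]; tauto))]
  rw [Nat.card_eq_fintype_card, Fintype.card_coe, Finset.offDiag_card, Finset.card_compl]
  simp
  rw [← Nat.mul_sub_one, Nat.sub_sub]

lemma card_N (k : ℕ) : Nat.card {c : Fin k × Fin k // c.1 = c.2} = k := by
  rw [Nat.card_congr (β := Fin k)
    { toFun := fun c => c.1.1
      invFun := fun c => ⟨(c, c), rfl⟩
      left_inv := fun c => by ext <;> simp [c.2]
      right_inv := fun c => rfl }]
  simp

lemma card_S (k : ℕ) : Nat.card {c : Fin k × Fin k // c.1 ≠ c.2} = k * (k - 1) := by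
  classical
  rw [Nat.card_congr (β := {c : Fin k × Fin k // c ∈ (Finset.univ : Finset (Fin k)).offDiag})
    (Equiv.subtypeEquivRight (fun c => by simp))]
  rw [Nat.card_eq_fintype_card, Fintype.card_coe, Finset.offDiag_card]
  simp [Nat.mul_sub_one]

lemma scount_leaf {V : Type} [Fintype V] (T : SimpleGraph V) (S : Set V) (k : ℕ) (x y : V)
    (hxy : T.Adj x y) (hl : ∀ z, T.Adj x z → z = y) (m : ℕ)
    (hm : ∀ a, SGood k S y a → Nat.card {c : Fin k × Fin k // SGood k S x c ∧ SDis c a} = m) :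
    scount T S k = scount (T.induce {x}ᶜ) {z | z.1 ∈ S} k * m := by
  classical
  have hy : y ∈ ({x}ᶜ : Set V) := by simpa using hxy.ne'
  unfold scount
  let E := Σ g : {f : ({x}ᶜ : Set V) → Fin k × Fin k //
      (∀ z, SGood k {z : ({x}ᶜ : Set V) | z.1 ∈ S} z (f z)) ∧
      ∀ z w, (T.induce {x}ᶜ).Adj z w → SDis (f z) (f w)},
      {c : Fin k × Fin k // SGood k S x c ∧ SDis c (g.1 ⟨y, hy⟩)}
  have hE : ∀ p q : E, p.1.1 = q.1.1 → p.2.1 = q.2.1 → p = q := by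
    rintro ⟨⟨g, hg⟩, ⟨c, hc⟩⟩ ⟨⟨g', hg'⟩, ⟨c', hc'⟩⟩ h1 h2
    dsimp only at h1 h2
    subst h1 h2
    rfl
  have hmem : ∀ z, ¬ z = x → z ∈ ({x}ᶜ : Set V) := fun z h => h
  let ext (p : E) (z : V) : Fin k × Fin k := if h : z = x then p.2.1 else p.1.1 ⟨z, hmem z h⟩
  have ext_x : ∀ p : E, ext p x = p.2.1 := fun p => by simp [ext]
  have ext_ne : ∀ (p : E) (z : V) (h : ¬ z = x), ext p z = p.1.1 ⟨z, hmem z h⟩ :=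
    fun p z h => by simp [ext, h]
  have hgood : ∀ (p : E) (z : V), SGood k S z (ext p z) := by
    intro p z
    by_cases h : z = x
    · rw [h, ext_x]; exact p.2.2.1
    · rw [ext_ne p z h]; exact p.1.2.1 ⟨z, h⟩
  have hdis : ∀ (p : E) (z w : V), T.Adj z w → SDis (ext p z) (ext p w) := by
    intro p z w hzw
    by_cases h : z = x
    · subst h
      have := hl _ hzw
      subst this
      rw [ext_x, ext_ne p w hzw.ne']
      exact p.2.2.2
    · by_cases h' : w = x
      · subst h'
        have := hl _ hzw.symm
        subst this
        rw [ext_x, ext_ne p z h]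
        exact p.2.2.2.symm
      · rw [ext_ne p z h, ext_ne p w h']
        exact p.1.2.2 ⟨z, h⟩ ⟨w, h'⟩ hzw
  refine (Nat.card_congr (β := E)
    { toFun := fun f => ⟨⟨fun z => f.1 z.1, fun z => f.2.1 z.1, fun z w h => f.2.2 _ _ h⟩,
        ⟨f.1 x, f.2.1 x, f.2.2 _ _ hxy⟩⟩
      invFun := fun p => ⟨ext p, hgood p, hdis p⟩
      left_inv := ?_
      right_inv := ?_ }).trans ?_
  · intro f
    apply Subtype.ext
    funext z
    by_cases h : z = x
    · subst h; exact ext_x _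
    · exact ext_ne _ z h
  · intro p
    apply hE
    · funext z
      exact ext_ne p z.1 z.2
    · exact ext_x p
  · rw [Nat.card_sigma, Finset.sum_congr rfl (fun g _ => hm _ (g.2.1 ⟨y, hy⟩))]
    simp

open Classical in
noncomputable def sB {V : Type} [Fintype V] (T : SimpleGraph V) (S : Set V) : ℕ :=
  ∑ p : V, ∑ q : V, if T.Adj p q ∧ p ∈ S then 1 else 0

open Classical in
noncomputable def sC {V : Type} [Fintype V] (S : Set V) : ℕ :=
  ∑ p : V, if p ∈ S then 1 else 0

open Classical in
lemma sum_split {V : Type} [Fintype V] (x : V) (F : V → ℕ) :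
    ∑ p, F p = F x + ∑ p : ({x}ᶜ : Set V), F p.1 := by
  rw [Fintype.sum_eq_add_sum_compl x]
  congr 1
  apply Finset.sum_subtype
  simp

open Classical in
lemma sC_leaf {V : Type} [Fintype V] (S : Set V) (x : V) :
    sC S = (if x ∈ S then 1 else 0) + sC {z : ({x}ᶜ : Set V) | z.1 ∈ S} := by
  unfold sC
  rw [sum_split x]
  simp

open Classical in
lemma sB_leaf {V : Type} [Fintype V] (T : SimpleGraph V) (S : Set V) (x y : V)
    (hxy : T.Adj x y) (hl : ∀ z, T.Adj x z → z = y) :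
    sB T S = (if x ∈ S then 1 else 0) + (if y ∈ S then 1 else 0) +
      sB (T.induce {x}ᶜ) {z | z.1 ∈ S} := by
  have hiff : ∀ z, T.Adj x z ↔ z = y := fun z => ⟨hl z, fun h => h ▸ hxy⟩
  have hiff' : ∀ z, T.Adj z x ↔ z = y := fun z => by rw [T.adj_comm, hiff]
  unfold sB
  rw [sum_split x]
  have h1 : (∑ q : V, if T.Adj x q ∧ x ∈ S then 1 else 0) = if x ∈ S then 1 else 0 := by
    simp only [hiff, ite_and]
    simp
  have h2 : ∀ p : V, (∑ q : V, if T.Adj p q ∧ p ∈ S then 1 else 0) =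
      (if p = y ∧ p ∈ S then 1 else 0) +
        ∑ q : ({x}ᶜ : Set V), if T.Adj p q.1 ∧ p ∈ S then 1 else 0 := by
    intro p
    rw [sum_split x]
    simp only [hiff']
  rw [h1]
  simp only [h2, Finset.sum_add_distrib]
  have h3 : (∑ p : ({x}ᶜ : Set V), if p.1 = y ∧ p.1 ∈ S then 1 else 0) = if y ∈ S then 1 else 0 := by
    have := sum_split x (fun p => if p = y ∧ p ∈ S then 1 else 0)
    simp only [hxy.ne, false_and, if_false, zero_add] at this
    rw [← this]
    simp only [ite_and]
    simp
  rw [h3, add_assoc]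
  rfl

lemma main_ind (k : ℕ) : ∀ (n : ℕ) (V : Type) [Fintype V] (T : SimpleGraph V), T.IsTree →
    ∀ S : Set V, (∀ x ∈ S, ∀ y ∈ S, ¬ T.Adj x y) → Fintype.card V = n + 1 →
    ∃ a, a + sB T S = n + sC S ∧ scount T S k = k * (k - 1) ^ a * (k - 2) ^ sB T S := by
  classical
  intro n
  induction n with
  | zero =>
    intro V _ T hT S hS hc
    obtain ⟨x, hx⟩ := Fintype.card_eq_one_iff.1 hc
    have hadj : ∀ p q, ¬ T.Adj p q := fun p q h => h.ne ((hx p).trans (hx q).symm)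
    have hB : sB T S = 0 := by simp [sB, hadj]
    have hC : sC S = if x ∈ S then 1 else 0 := by
      unfold sC
      rw [Finset.sum_eq_single x (fun b _ hb => (hb (hx b)).elim) (by simp)]
    have hcount : scount T S k = Nat.card {c : Fin k × Fin k // SGood k S x c} := by
      unfold scount
      exact Nat.card_congr
        { toFun := fun f => ⟨f.1 x, f.2.1 x⟩
          invFun := fun c => ⟨fun _ => c.1, fun z => by rw [hx z]; exact c.2,
            fun p q h => (hadj p q h).elim⟩
          left_inv := fun f => by ext1; funext z; rw [hx z]
          right_inv := fun c => rfl }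
    rw [hcount, hB]
    refine ⟨sC S, by simp, ?_⟩
    by_cases h : x ∈ S
    · rw [hC]; simpa [SGood, h] using card_S k
    · rw [hC]; simpa [SGood, h] using card_N k
  | succ n ih =>
    intro V _ T hT S hS hc
    have : Nontrivial V := Fintype.one_lt_card_iff_nontrivial.1 (by omega)
    obtain ⟨x, hx⟩ := hT.exists_vert_degree_one_of_nontrivial
    obtain ⟨y, hxy, hl⟩ := SimpleGraph.degree_eq_one_iff_existsUnique_adj.1 hx
    have hT' : (T.induce {x}ᶜ).IsTree :=
      ⟨hT.1.induce_compl_singleton_of_degree_eq_one hx, hT.2.induce _⟩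
    obtain ⟨a, ha, hcnt⟩ := ih _ (T.induce {x}ᶜ) hT' {z | z.1 ∈ S}
      (fun p hp q hq h => hS _ hp _ hq h) (by
        rw [Fintype.card_compl_set]; simp [hc])
    have hB := sB_leaf T S x y hxy hl
    have hC := sC_leaf S x
    by_cases h1 : x ∈ S
    · have h2 : y ∉ S := fun h => hS x h1 y h hxy
      have := scount_leaf T S k x y hxy hl ((k - 1) * (k - 2)) (fun a ha => by
        simpa [SGood, h1] using card_NS a (by simpa [SGood, h2] using ha))
      simp only [h1, h2, if_true, if_false] at hB hC
      refine ⟨a + 1, by omega, ?_⟩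
      rw [this, hcnt, hB]
      ring
    · by_cases h2 : y ∈ S
      · have := scount_leaf T S k x y hxy hl (k - 2) (fun a ha => by
          simpa [SGood, h1] using card_SN a (by simpa [SGood, h2] using ha))
        simp only [h1, h2, if_true, if_false] at hB hC
        refine ⟨a, by omega, ?_⟩
        rw [this, hcnt, hB]
        ring
      · have := scount_leaf T S k x y hxy hl (k - 1) (fun a ha => by
          simpa [SGood, h1] using card_NN a (by simpa [SGood, h2] using ha))
        simp only [h1, h2, if_false] at hB hC
        refine ⟨a + 1, by omega, ?_⟩
        rw [this, hcnt, hB]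
        ring

/-- For a tree `T` on `n` vertices and distinct non-adjacent vertices `u, v`, the shadow
graph on `{u, v}` has exactly `k·(k-1)^{n-deg(u)-deg(v)+1}·(k-2)^{deg(u)+deg(v)}`
proper `k`-colorings. -/
theorem tree_shadow_nonadjacent_pair {V : Type} [Fintype V] [DecidableEq V]
    (T : SimpleGraph V) (hT : T.IsTree) (n : ℕ) (hn : Fintype.card V = n)
    (u v : V) (hne : u ≠ v) (huv : ¬ T.Adj u v) (k : ℕ) :
    numColorings (multiShadow T {u, v}) k =
      k * (k - 1) ^ (n + 1 - ((T.neighborSet u).ncard + (T.neighborSet v).ncard)) *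
        (k - 2) ^ ((T.neighborSet u).ncard + (T.neighborSet v).ncard) := by
  classical
  rw [shadow_eq_scount]
  have hpos : 0 < Fintype.card V := Fintype.card_pos_iff.2 ⟨u⟩
  obtain ⟨a, ha, hcnt⟩ := main_ind k (n - 1) V T hT (({u, v} : Finset V) : Set V)
    (by
      have huv' : ¬ T.Adj v u := fun h => huv h.symm
      simp [huv, huv']) (by omega)
  have hC : sC (({u, v} : Finset V) : Set V) = 2 := by
    unfold sC
    simp only [Finset.mem_coe]
    rw [Finset.sum_ite_mem]
    simp [Finset.card_pair hne]
  have hd : ∀ w, (∑ q : V, if T.Adj w q then 1 else 0) = (T.neighborSet w).ncard := by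
    intro w
    rw [Set.ncard_eq_toFinset_card']
    simp [← SimpleGraph.card_neighborSet_eq_degree, Fintype.card_subtype]
  have hB : sB T (({u, v} : Finset V) : Set V) =
      (T.neighborSet u).ncard + (T.neighborSet v).ncard := by
    unfold sB
    simp only [Finset.mem_coe, and_comm (b := _ ∈ ({u, v} : Finset V)), ite_and]
    have : ∀ p : V, (∑ q : V, if p ∈ ({u, v} : Finset V) then (if T.Adj p q then 1 else 0) else 0)
        = if p ∈ ({u, v} : Finset V) then (T.neighborSet p).ncard else 0 := by
      intro p
      rw [← hd]
      split_ifs <;> simp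
    simp only [this]
    rw [Finset.sum_ite_mem, Finset.univ_inter, Finset.sum_pair hne]
  rw [hcnt, hB]
  rw [hB, hC] at ha
  congr 3
  omega
end

section
/- The number of induced d-dimensional hypercubes Q_d in the coloring graph C_k(T) of a tree T on n vertices equals (1/2^d)·Σ_{S⊆V(T), |S|=d} k·(k-1)^{n+d-1-deg(S)}·(k-2)^{deg(S)-int(S)}·(k-3)^{int(S)}. -/
/-- The `k`-coloring graph of `G`: vertices are proper `k`-colorings of `G`, and two
colorings are adjacent iff they differ at exactly one vertex. -/
def coloringGraph {V : Type} (G : SimpleGraph V) (k : ℕ) :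
    SimpleGraph {f : V → Fin k // ∀ u w, G.Adj u w → f u ≠ f w} :=
  SimpleGraph.fromRel (fun f g => ∃ v, ∀ u, u ≠ v → f.1 u = g.1 u)

/-- The `d`-dimensional hypercube graph `Q_d`: vertices are `0/1`-vectors of length `d`,
adjacent iff they differ in exactly one coordinate. -/
def hypercube (d : ℕ) : SimpleGraph (Fin d → Bool) :=
  SimpleGraph.fromRel (fun x y => ∃ i, ∀ j, j ≠ i → x j = y j)

/-- The number of induced copies of `H` in `X` (vertex subsets inducing a graph
isomorphic to `H`). -/
noncomputable def numInduced {W β : Type} (X : SimpleGraph W) (H : SimpleGraph β) : ℕ :=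
  Nat.card {s : Set W // Nonempty ((X.induce s) ≃g H)}

/-- Sum of the degrees of the vertices in `S`. -/
noncomputable def degSum {V : Type} (G : SimpleGraph V) (S : Finset V) : ℕ :=
  ∑ v ∈ S, (G.neighborSet v).ncard

/-- The number of edges of `G` with both endpoints in `S`. -/
noncomputable def intEdges {V : Type} (G : SimpleGraph V) (S : Finset V) : ℕ :=
  {e : Sym2 V | e ∈ G.edgeSet ∧ ∀ x ∈ e, x ∈ S}.ncard

namespace TreeHyper

/-- Two colour pairs are disjoint. -/
def Dis {k : ℕ} (p q : Fin k × Fin k) : Prop :=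
  p.1 ≠ q.1 ∧ p.1 ≠ q.2 ∧ p.2 ≠ q.1 ∧ p.2 ≠ q.2

lemma Dis.symm {k : ℕ} {p q : Fin k × Fin k} (h : Dis p q) : Dis q p :=
  ⟨h.1.symm, h.2.2.1.symm, h.2.1.symm, h.2.2.2.symm⟩

/-- Pair colourings whose splitting set is `P`. -/
def Good {V : Type} (G : SimpleGraph V) (k : ℕ) (P : V → Prop) (c : V → Fin k × Fin k) : Prop :=
  (∀ v, (c v).1 ≠ (c v).2 ↔ P v) ∧ ∀ u w, G.Adj u w → Dis (c u) (c w)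

open Classical in
/-- Number of darts starting in `P`. -/
noncomputable def dD {V : Type} [Fintype V] (G : SimpleGraph V) (P : V → Prop) : ℕ :=
  ∑ u, ∑ w, if P u ∧ G.Adj u w then 1 else 0

open Classical in
/-- Number of darts inside `P`. -/
noncomputable def dI {V : Type} [Fintype V] (G : SimpleGraph V) (P : V → Prop) : ℕ :=
  ∑ u, ∑ w, if (P u ∧ P w) ∧ G.Adj u w then 1 else 0

open Classical in
/-- Size of `P`. -/
noncomputable def dC {V : Type} [Fintype V] (P : V → Prop) : ℕ :=
  ∑ u : V, if P u then 1 else 0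

open Classical in
lemma leaf_card {k : ℕ} (p : Fin k × Fin k) (Pl : Prop) :
    Nat.card {q : Fin k × Fin k // (q.1 ≠ q.2 ↔ Pl) ∧ Dis q p} =
      (k - if p.1 ≠ p.2 then 2 else 1) *
      (if Pl then (k - if p.1 ≠ p.2 then 3 else 2) else 1) := by
  obtain ⟨a, b⟩ := p
  have hA : ((Finset.univ : Finset (Fin k)) \ {a, b}).card = (k - if a ≠ b then 2 else 1) := by
    rw [Finset.card_sdiff_of_subset (Finset.subset_univ _)]
    by_cases h : a = b <;> simp [h]
  set A := ((Finset.univ : Finset (Fin k)) \ {a, b}) with hAdef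
  rw [Nat.card_eq_fintype_card, Fintype.card_subtype]
  by_cases hl : Pl
  · have : (Finset.univ.filter fun q : Fin k × Fin k => (q.1 ≠ q.2 ↔ Pl) ∧ Dis q (a, b))
        = A.offDiag := by
      ext ⟨x, y⟩
      simp [hl, Dis, hAdef, Finset.mem_offDiag]
      tauto
    rw [this, Finset.offDiag_card, hA]
    simp only [hl, if_true]
    split_ifs
    · rw [show k - 3 = (k - 2) - 1 by omega, Nat.mul_sub_one]
    · rw [show k - 2 = (k - 1) - 1 by omega, Nat.mul_sub_one (k - 1) (k - 1)]
  · have : (Finset.univ.filter fun q : Fin k × Fin k => (q.1 ≠ q.2 ↔ Pl) ∧ Dis q (a, b))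
        = A.diag := by
      ext ⟨x, y⟩
      simp only [hl, Dis, hAdef, Finset.mem_diag, Finset.mem_filter, Finset.mem_univ, true_and,
        Finset.mem_sdiff, Finset.mem_insert, Finset.mem_singleton, iff_false, not_not, not_or]
      constructor
      · rintro ⟨rfl, h⟩; tauto
      · rintro ⟨h, rfl⟩; tauto
    rw [this, Finset.diag_card, hA]
    simp [hl]

open Classical in
lemma good_leaf {V : Type} [Fintype V] (G : SimpleGraph V) (k : ℕ) (P : V → Prop)
    (l p : V) (hlp : ∀ w, G.Adj l w ↔ w = p) :
    Nat.card {c // Good G k P c} =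
      Nat.card {c // Good (G.comap (Subtype.val : {v // v ≠ l} → V)) k (fun v => P v.1) c} *
      ((k - if P p then 2 else 1) * (if P l then (k - if P p then 3 else 2) else 1)) := by
  have hpl : p ≠ l := by
    rintro rfl
    exact G.irrefl ((hlp p).2 rfl)
  let e : {c // Good G k P c} ≃
      Σ c : {c // Good (G.comap (Subtype.val : {v // v ≠ l} → V)) k (fun v => P v.1) c},
        {q : Fin k × Fin k // (q.1 ≠ q.2 ↔ P l) ∧ Dis q (c.1 ⟨p, hpl⟩)} :=
    { toFun := fun c => ⟨⟨fun v => c.1 v.1, fun v => c.2.1 v.1, fun u w h => c.2.2 _ _ h⟩,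
        ⟨c.1 l, c.2.1 l, c.2.2 _ _ ((hlp p).2 rfl)⟩⟩
      invFun := fun x => ⟨fun v => if h : v = l then x.2.1 else x.1.1 ⟨v, h⟩, by
        obtain ⟨⟨c, hc1, hc2⟩, ⟨q, hq1, hq2⟩⟩ := x
        refine ⟨fun v => ?_, fun u w huw => ?_⟩
        · by_cases h : v = l
          · subst h; simpa using hq1
          · simpa [h] using hc1 ⟨v, h⟩
        · by_cases hu : u = l
          · subst hu
            have : w = p := (hlp w).1 huw
            subst this
            simpa [hpl] using hq2
          · by_cases hw : w = l
            · subst hw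
              have : u = p := (hlp u).1 huw.symm
              subst this
              simpa [hpl] using hq2.symm
            · simpa [hu, hw] using hc2 ⟨u, hu⟩ ⟨w, hw⟩ huw⟩
      left_inv := by
        intro c
        ext v : 2
        by_cases h : v = l
        · subst h; simp
        · simp [h]
      right_inv := by
        rintro ⟨⟨c, hc1, hc2⟩, ⟨q, hq1, hq2⟩⟩
        have : (fun v : {v // v ≠ l} => if h : v.1 = l then q else c ⟨v.1, h⟩) = c := by
          ext1 v
          simp [v.2]
        refine Sigma.subtype_ext (Subtype.ext this) ?_
        simp }
  rw [Nat.card_congr e, Nat.card_sigma]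
  have : ∀ c : {c // Good (G.comap (Subtype.val : {v // v ≠ l} → V)) k (fun v => P v.1) c},
      Nat.card {q : Fin k × Fin k // (q.1 ≠ q.2 ↔ P l) ∧ Dis q (c.1 ⟨p, hpl⟩)} =
      ((k - if P p then 2 else 1) * (if P l then (k - if P p then 3 else 2) else 1)) := by
    intro c
    rw [leaf_card]
    simp only [c.2.1]
  rw [Finset.sum_congr rfl (fun c _ => this c)]
  simp [Nat.card_eq_fintype_card]

open Classical in
lemma d_leaf {V : Type} [Fintype V] (G : SimpleGraph V) (P : V → Prop)
    (l p : V) (hlp : ∀ w, G.Adj l w ↔ w = p) :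
    dD G P = dD (G.comap (Subtype.val : {v // v ≠ l} → V)) (fun v => P v.1) +
        (if P l then 1 else 0) + (if P p then 1 else 0) ∧
    dI G P = dI (G.comap (Subtype.val : {v // v ≠ l} → V)) (fun v => P v.1) +
        2 * (if P l ∧ P p then 1 else 0) ∧
    dC P = dC (fun v : {v // v ≠ l} => P v.1) + (if P l then 1 else 0) := by
  have hlp' : ∀ w, G.Adj w l ↔ w = p := fun w => by rw [G.adj_comm]; exact hlp w
  have hpl : p ≠ l := by
    rintro rfl
    exact G.irrefl ((hlp p).2 rfl)
  have key : ∀ (Q : V → Prop) [∀ x : {v // v ≠ l}, Decidable (Q x.1 ∧ x.1 = p)] [Decidable (Q p)],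
      (∑ x : {v // v ≠ l}, if Q x.1 ∧ x.1 = p then 1 else 0) =
      if Q p then 1 else 0 := by
    intro Q _ _
    rw [Finset.sum_eq_single (⟨p, hpl⟩ : {v // v ≠ l})]
    · simp
    · intro b _ hb
      rw [if_neg]
      rintro ⟨_, h⟩
      exact hb (Subtype.ext h)
    · simp
  refine ⟨?_, ?_, ?_⟩
  · unfold dD
    rw [Fintype.sum_eq_add_sum_subtype_ne _ l]
    simp_rw [fun u => Fintype.sum_eq_add_sum_subtype_ne (fun w => if P u ∧ G.Adj u w then 1 else 0) l]
    rw [Finset.sum_add_distrib]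
    simp only [hlp, hlp', SimpleGraph.comap_adj]
    rw [key, key (fun _ => P l)]
    simp [hpl.symm]
    ring
  · unfold dI
    rw [Fintype.sum_eq_add_sum_subtype_ne _ l]
    simp_rw [fun u => Fintype.sum_eq_add_sum_subtype_ne
      (fun w => if (P u ∧ P w) ∧ G.Adj u w then 1 else 0) l]
    rw [Finset.sum_add_distrib]
    simp only [hlp, hlp', SimpleGraph.comap_adj]
    rw [key (fun x => P l ∧ P x), key (fun x => P x ∧ P l)]
    simp only [hpl.symm, and_comm, false_and, if_false]
    ring
  · unfold dC
    rw [Fintype.sum_eq_add_sum_subtype_ne _ l]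
    ring

lemma good_count (k : ℕ) : ∀ (n : ℕ) {V : Type} [Fintype V] (G : SimpleGraph V) (_ : G.IsTree)
    (_ : Fintype.card V = n + 1) (P : V → Prop),
    ∃ a b c : ℕ, 2 * c = dI G P ∧ b + c = dD G P ∧ a + dD G P = n + dC P ∧
      Nat.card {c // Good G k P c} = k * (k - 1) ^ a * (k - 2) ^ b * (k - 3) ^ c := by
  classical
  intro n
  induction n with
  | zero =>
    intro V _ G _ hV P
    obtain ⟨v, hv⟩ := Fintype.card_eq_one_iff.1 (by simpa using hV)
    have : Unique V := ⟨⟨v⟩, hv⟩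
    have hadj : ∀ u w, ¬ G.Adj u w := by
      intro u w h
      exact h.ne (Subsingleton.elim _ _)
    have hD : dD G P = 0 := by simp [dD, hadj]
    have hI : dI G P = 0 := by simp [dI, hadj]
    have hC : dC P = if P v then 1 else 0 := by
      simp only [dC, Fintype.sum_unique]
      rw [Subsingleton.elim default v]
    refine ⟨if P v then 1 else 0, 0, 0, by simp [hI], by simp [hD], by simp [hD, hC], ?_⟩
    let e : {c // Good G k P c} ≃ {q : Fin k × Fin k // q.1 ≠ q.2 ↔ P v} :=
      { toFun := fun c => ⟨c.1 v, c.2.1 v⟩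
        invFun := fun q => ⟨fun _ => q.1, fun u => by rw [hv u]; exact q.2,
          fun u w h => (hadj _ _ h).elim⟩
        left_inv := fun c => by
          ext u : 2
          simp [hv u]
        right_inv := fun q => rfl }
    rw [Nat.card_congr e, Nat.card_eq_fintype_card, Fintype.card_subtype]
    by_cases h : P v
    · have : (Finset.univ.filter fun q : Fin k × Fin k => (q.1 ≠ q.2 ↔ P v))
        = Finset.univ.offDiag := by
        ext ⟨x, y⟩
        simp [h]
      rw [this, Finset.offDiag_card]
      simp [h, Nat.mul_sub]
    · have : (Finset.univ.filter fun q : Fin k × Fin k => (q.1 ≠ q.2 ↔ P v))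
        = Finset.univ.diag := by
        ext ⟨x, y⟩
        simp [h]
      rw [this, Finset.diag_card]
      simp [h]
  | succ n ih =>
    intro V _ G hG hV P
    have : Nontrivial V := Fintype.one_lt_card_iff_nontrivial.1 (by omega)
    obtain ⟨l, hl⟩ := hG.exists_vert_degree_one_of_nontrivial
    have hconn := hG.1.induce_compl_singleton_of_degree_eq_one hl
    have hac := hG.2.induce {l}ᶜ
    obtain ⟨p, hp, hp'⟩ := SimpleGraph.degree_eq_one_iff_existsUnique_adj.1 hl
    have hlp : ∀ w, G.Adj l w ↔ w = p := fun w => ⟨hp' w, fun h => h ▸ hp⟩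
    have htree : (G.comap (Subtype.val : {v // v ≠ l} → V)).IsTree := ⟨hconn, hac⟩
    obtain ⟨a, b, c, h1, h2, h3, h4⟩ := ih _ htree
      (by rw [Fintype.card_subtype_compl, hV]; simp) (fun v => P v.1)
    obtain ⟨e1, e2, e3⟩ := d_leaf G P l p hlp
    rw [good_leaf G k P l p hlp, h4]
    by_cases hPl : P l <;> by_cases hPp : P p <;> simp only [hPl, hPp, if_true, if_false, and_true, and_false] at e1 e2 e3 ⊢
    · exact ⟨a, b + 1, c + 1, by omega, by omega, by omega, by ring⟩
    · exact ⟨a + 1, b + 1, c, by omega, by omega, by omega, by ring⟩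
    · exact ⟨a, b + 1, c, by omega, by omega, by omega, by ring⟩
    · exact ⟨a + 1, b, c, by omega, by omega, by omega, by ring⟩

lemma card_aux {V : Type} [Fintype V] (Q : V → Prop) {inst : DecidablePred Q} (S : Finset V)
    (h : ∀ v, v ∈ S ↔ Q v) : S.card = ∑ w, if Q w then 1 else 0 := by
  rw [← Finset.card_filter]
  congr 1
  ext v
  simp [h]

open Classical in
lemma degSum_eq {V : Type} [Fintype V] (G : SimpleGraph V) (S : Finset V) :
    degSum G S = dD G (· ∈ S) := by
  unfold degSum dD
  rw [← Finset.sum_filter_add_sum_filter_not Finset.univ (· ∈ S) (fun u => ∑ w, _)]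
  rw [Finset.sum_eq_zero (s := Finset.univ.filter (fun u => ¬ u ∈ S)), add_zero]
  · have : Finset.univ.filter (· ∈ S) = S := by ext; simp
    rw [this]
    refine Finset.sum_congr rfl fun u hu => ?_
    simp only [hu, true_and]
    rw [Finset.sum_boole, Set.ncard_eq_toFinset_card']
    simp
  · intro u hu
    simp at hu
    simp [hu]

open Classical in
lemma intEdges_eq {V : Type} [Fintype V] (G : SimpleGraph V) (S : Finset V) :
    2 * intEdges G S = dI G (· ∈ S) := by
  let H : SimpleGraph V :=
    { Adj := fun u w => (u ∈ S ∧ w ∈ S) ∧ G.Adj u w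
      symm := ⟨fun u w h => ⟨⟨h.1.2, h.1.1⟩, h.2.symm⟩⟩
      loopless := ⟨fun u h => G.irrefl h.2⟩ }
  have h := H.sum_degrees_eq_twice_card_edges
  have : intEdges G S = H.edgeFinset.card := by
    unfold intEdges
    rw [← Set.ncard_coe_finset]
    congr 1
    ext e
    induction e with
    | _ u w => simp [H]; tauto
  rw [this, ← h]
  unfold dI
  refine Finset.sum_congr rfl fun u _ => ?_
  rw [← SimpleGraph.card_neighborFinset_eq_degree]
  refine card_aux _ _ fun w => ?_
  simp [H]

lemma count_final {V : Type} [Fintype V] (T : SimpleGraph V) (hT : T.IsTree) (k : ℕ)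
    (S : Finset V) :
    Nat.card {c // Good T k (· ∈ S) c} =
      k * (k - 1) ^ (Fintype.card V + S.card - 1 - degSum T S) *
          (k - 2) ^ (degSum T S - intEdges T S) * (k - 3) ^ (intEdges T S) := by
  classical
  have := hT.1.nonempty
  have hpos : 0 < Fintype.card V := Fintype.card_pos
  obtain ⟨a, b, c, h1, h2, h3, h4⟩ := good_count k (Fintype.card V - 1) T hT (by omega) (· ∈ S)
  have hC : dC (· ∈ S) = S.card := by
    unfold dC
    exact (card_aux _ _ fun w => Iff.rfl).symm
  rw [← degSum_eq] at h2 h3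
  rw [← intEdges_eq] at h1
  rw [h4, show Fintype.card V + S.card - 1 - degSum T S = a by omega,
    show degSum T S - intEdges T S = b by omega, show intEdges T S = c by omega]

end TreeHyper

namespace TreeHyper

/-- Flip the `i`-th coordinate. -/
def flp {d : ℕ} (i : Fin d) (x : Fin d → Bool) : Fin d → Bool := Function.update x i (!x i)

lemma flp_self {d : ℕ} (i : Fin d) (x : Fin d → Bool) : flp i x i = !x i := by simp [flp]

lemma flp_ne {d : ℕ} {i j : Fin d} (h : j ≠ i) (x : Fin d → Bool) : flp i x j = x j := by
  simp [flp, h]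

lemma flp_neq {d : ℕ} (i : Fin d) (x : Fin d → Bool) : flp i x ≠ x := by
  intro h
  have := congrFun h i
  simp [flp_self] at this

lemma flp_flp {d : ℕ} (i : Fin d) (x : Fin d → Bool) : flp i (flp i x) = x := by
  ext j
  by_cases h : j = i
  · subst h; simp [flp_self]
  · simp [flp_ne h]

lemma flp_comm {d : ℕ} {i j : Fin d} (h : i ≠ j) (x : Fin d → Bool) :
    flp i (flp j x) = flp j (flp i x) := by
  ext m
  by_cases h1 : m = i
  · subst h1; simp [flp_self, flp_ne h]
  · by_cases h2 : m = j
    · subst h2; simp [flp_self, flp_ne h1]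
    · simp [flp_ne h1, flp_ne h2]

lemma flp_inv {d : ℕ} {α : Type*} (F : (Fin d → Bool) → α) (A : Finset (Fin d)) :
    (∀ j ∈ A, ∀ x, F (flp j x) = F x) → ∀ x y : Fin d → Bool, (∀ j ∉ A, x j = y j) → F x = F y := by
  induction A using Finset.induction_on with
  | empty =>
    intro _ x y h
    rw [show x = y from funext fun j => h j (by simp)]
  | insert a s ha ih =>
    intro hF x y h
    have h1 : F (Function.update x a (y a)) = F x := by
      by_cases hxy : x a = y a
      · rw [← hxy, Function.update_eq_self]
      · rw [← hF a (by simp) x]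
        congr 1
        unfold flp
        congr 1
        cases hx : x a <;> cases hy : y a <;> simp_all
    rw [← h1]
    refine ih (fun j hj => hF j (by simp [hj])) _ _ fun j hj => ?_
    by_cases hja : j = a
    · subst hja; simp
    · rw [Function.update_of_ne hja]
      exact h j (by simp [hja, hj])

lemma cube_directions {d k : ℕ} {V : Type} (φ : (Fin d → Bool) → V → Fin k)
    (hinj : Function.Injective φ)
    (hadj : ∀ x y, x ≠ y → ((∃ v, ∀ u, u ≠ v → φ x u = φ y u) ↔ ∃ i, ∀ j, j ≠ i → x j = y j)) :
    ∃ p : Fin d → V, Function.Injective p ∧ ∀ x i u, u ≠ p i → φ (flp i x) u = φ x u := by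
  have hex : ∀ x i, ∃ v, ∀ u, u ≠ v → φ (flp i x) u = φ x u := fun x i =>
    (hadj _ _ (flp_neq i x)).2 ⟨i, fun j hj => flp_ne hj x⟩
  choose L hL using hex
  have hLne : ∀ x i, φ (flp i x) (L x i) ≠ φ x (L x i) := by
    intro x i h
    apply flp_neq i x
    apply hinj
    ext1 u
    by_cases hu : u = L x i
    · rw [hu, h]
    · exact hL x i u hu
  have huniq : ∀ x i u, φ (flp i x) u ≠ φ x u → u = L x i := fun x i u h => by
    by_contra hc
    exact h (hL x i u hc)
  have hLinj : ∀ x i j, i ≠ j → L x i ≠ L x j := by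
    intro x i j hij h
    have hne : flp i x ≠ flp j x := by
      intro h
      have := congrFun h i
      rw [flp_self, flp_ne hij] at this
      simp at this
    obtain ⟨m, hm⟩ := (hadj _ _ hne).1 ⟨L x i, fun u hu => by
      rw [hL x i u hu, hL x j u (h ▸ hu)]⟩
    by_cases hmi : m = i
    · have := hm j (by rw [hmi]; exact hij.symm)
      rw [flp_self, flp_ne hij.symm] at this
      simp at this
    · have := hm i (Ne.symm hmi)
      rw [flp_self, flp_ne hij] at this
      simp at this
  have hLflip : ∀ i j x, L (flp j x) i = L x i := by
    intro i j x
    by_cases hij : i = j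
    · subst hij
      apply Eq.symm
      apply huniq
      rw [flp_flp]
      exact (hLne x i).symm
    · by_contra hne
      have h1 : φ (flp j x) (L x i) = φ x (L x i) := hL x j _ (hLinj x i j hij)
      have h2 : φ (flp i (flp j x)) (L x i) = φ (flp j x) (L x i) := hL _ i _ (Ne.symm hne)
      have h3 : L x i = L (flp i x) j := by
        apply huniq
        rw [← flp_comm hij, h2, h1]
        exact (hLne x i).symm
      have h4 : φ (flp i (flp j x)) = φ x := by
        ext1 u
        by_cases hu : u = L x i
        · rw [hu, h2, h1]
        · rw [flp_comm hij, hL (flp i x) j u (h3 ▸ hu), hL x i u hu]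
      have h5 := congrFun (hinj h4) i
      rw [flp_self, flp_ne hij] at h5
      simp at h5
  have hconst : ∀ i x y, L x i = L y i := fun i x y =>
    flp_inv (fun x => L x i) Finset.univ (fun j _ x => hLflip i j x) x y (by simp)
  refine ⟨L (fun _ => false), fun i j h => ?_, fun x i u hu => ?_⟩
  · by_contra hij
    exact hLinj _ _ _ hij h
  · exact hL x i u (by rwa [hconst i x (fun _ => false)])

/-- The set of colourings choosing one colour from every pair. -/
def cube {V : Type} (G : SimpleGraph V) {k : ℕ} (c : V → Fin k × Fin k) :
    Set {f : V → Fin k // ∀ u w, G.Adj u w → f u ≠ f w} :=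
  {h | ∀ v, h.1 v = (c v).1 ∨ h.1 v = (c v).2}

lemma proper_of_mem {V : Type} {G : SimpleGraph V} {k : ℕ} {P : V → Prop}
    {c : V → Fin k × Fin k} (hc : Good G k P c) (h : V → Fin k)
    (hh : ∀ v, h v = (c v).1 ∨ h v = (c v).2) : ∀ u w, G.Adj u w → h u ≠ h w := by
  intro u w huw
  obtain ⟨h1, h2, h3, h4⟩ := hc.2 u w huw
  rcases hh u with hu | hu <;> rcases hh w with hw | hw <;> rw [hu, hw] <;> assumption

lemma col_adj {V : Type} (G : SimpleGraph V) (k : ℕ)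
    (f g : {f : V → Fin k // ∀ u w, G.Adj u w → f u ≠ f w}) :
    (coloringGraph G k).Adj f g ↔ f ≠ g ∧ ∃ v, ∀ u, u ≠ v → f.1 u = g.1 u := by
  unfold coloringGraph
  rw [SimpleGraph.fromRel_adj]
  refine and_congr_right fun _ => ⟨?_, Or.inl⟩
  rintro (h | ⟨v, hv⟩)
  · exact h
  · exact ⟨v, fun u hu => (hv u hu).symm⟩

lemma cube_adj (d : ℕ) (x y : Fin d → Bool) :
    (hypercube d).Adj x y ↔ x ≠ y ∧ ∃ i, ∀ j, j ≠ i → x j = y j := by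
  unfold hypercube
  rw [SimpleGraph.fromRel_adj]
  refine and_congr_right fun _ => ⟨?_, Or.inl⟩
  rintro (h | ⟨v, hv⟩)
  · exact h
  · exact ⟨v, fun u hu => (hv u hu).symm⟩

lemma cube_iso {V : Type} (G : SimpleGraph V) {k d : ℕ} (S : Finset V) (hS : S.card = d)
    (c : V → Fin k × Fin k) (hc : Good G k (· ∈ S) c) :
    Nonempty (((coloringGraph G k).induce (cube G c)) ≃g hypercube d) := by
  classical
  let ε : Fin d ≃ S := (S.equivFinOfCardEq hS).symm
  have hne : ∀ v ∈ S, (c v).1 ≠ (c v).2 := fun v hv => (hc.1 v).2 hv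
  have heq : ∀ v ∉ S, (c v).1 = (c v).2 := fun v hv => by
    by_contra h
    exact hv ((hc.1 v).1 h)
  let inv : (Fin d → Bool) → V → Fin k := fun x v =>
    if hv : v ∈ S then (if x (ε.symm ⟨v, hv⟩) then (c v).2 else (c v).1) else (c v).1
  have hinv : ∀ x v, inv x v = (c v).1 ∨ inv x v = (c v).2 := by
    intro x v
    simp only [inv]
    split_ifs <;> simp
  have hoff : ∀ h ∈ cube G c, ∀ v ∉ S, h.1 v = (c v).1 := by
    intro h hh v hv
    rcases hh v with h1 | h1
    · exact h1
    · rw [h1, heq v hv]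
  let e : cube G c ≃ (Fin d → Bool) :=
    { toFun := fun h i => decide (h.1.1 (ε i).1 = (c (ε i).1).2)
      invFun := fun x => ⟨⟨inv x, proper_of_mem hc _ (hinv x)⟩, hinv x⟩
      left_inv := by
        intro h
        apply Subtype.ext
        apply Subtype.ext
        ext1 v
        by_cases hv : v ∈ S
        · simp only [inv, hv, dif_pos, Equiv.apply_symm_apply, decide_eq_true_eq]
          split_ifs with h1
          · exact h1.symm
          · exact ((h.2 v).resolve_right h1).symm
        · simp only [inv, hv, dif_neg, not_false_iff]
          exact (hoff h.1 h.2 v hv).symm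
      right_inv := by
        intro x
        ext1 i
        have hm : (ε i).1 ∈ S := (ε i).2
        have h1 := hne _ hm
        simp only [inv, hm, dif_pos, Subtype.coe_eta, Equiv.symm_apply_apply]
        cases hx : x i
        · simpa using h1
        · simp }
  have hcoord : ∀ (h h' : cube G c) (i : Fin d), e h i = e h' i ↔ h.1.1 (ε i).1 = h'.1.1 (ε i).1 := by
    intro h h' i
    have h1 := hne _ (ε i).2
    simp only [e, Equiv.coe_fn_mk, decide_eq_decide]
    rcases h.2 (ε i).1 with a | a <;> rcases h'.2 (ε i).1 with b | b <;> rw [a, b] <;> simp [h1, h1.symm]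
  refine ⟨⟨e, ?_⟩⟩
  intro h h'
  rw [cube_adj, SimpleGraph.comap_adj, col_adj]
  have hiff : e h ≠ e h' ↔ (Function.Embedding.subtype (· ∈ cube G c)) h ≠ (Function.Embedding.subtype (· ∈ cube G c)) h' := by
    rw [e.injective.ne_iff]
    simp [Subtype.ext_iff]
  refine (and_congr_right fun hn => ?_).trans (and_congr_left' hiff)
  constructor
  · rintro ⟨i, hi⟩
    refine ⟨(ε i).1, fun u hu => ?_⟩
    change h.1.1 u = h'.1.1 u
    by_cases huS : u ∈ S
    · have := hi (ε.symm ⟨u, huS⟩) (by rintro rfl; simp at hu)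
      rw [hcoord] at this
      simpa using this
    · rw [hoff _ h.2 u huS, hoff _ h'.2 u huS]
  · rintro ⟨v, hv⟩
    by_cases hvS : v ∈ S
    · refine ⟨ε.symm ⟨v, hvS⟩, fun j hj => ?_⟩
      rw [hcoord]
      refine hv _ fun hc => hj ?_
      rw [Equiv.eq_symm_apply]
      exact Subtype.ext hc
    · exfalso
      apply hn
      ext1 i
      rw [hcoord]
      exact hv _ fun hc => hvS (hc ▸ (ε i).2)

lemma cube_surj {V : Type} (G : SimpleGraph V) {k d : ℕ}
    (s : Set {f : V → Fin k // ∀ u w, G.Adj u w → f u ≠ f w})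
    (e : ((coloringGraph G k).induce s) ≃g hypercube d) (f : s) :
    ∃ (S : Finset V) (c : V → Fin k × Fin k), S.card = d ∧ Good G k (· ∈ S) c ∧ cube G c = s ∧
      ∀ v, (c v).1 = f.1.1 v := by
  classical
  let φ : (Fin d → Bool) → V → Fin k := fun x => (e.symm x).1.1
  have hinj : Function.Injective φ := by
    intro x y h
    exact e.symm.injective (Subtype.ext (Subtype.ext h))
  obtain ⟨p, hp, hflip⟩ := cube_directions φ hinj (by
    intro x y hxy
    have h1 := e.symm.map_adj_iff (v := x) (w := y)
    rw [cube_adj, SimpleGraph.comap_adj, col_adj] at h1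
    have h2 : (Function.Embedding.subtype (· ∈ s)) (e.symm x) ≠
        (Function.Embedding.subtype (· ∈ s)) (e.symm y) := by
      intro h
      exact hxy (e.symm.injective (Subtype.ext h))
    simp only [hxy, h2, true_and, ne_eq, not_false_iff] at h1
    exact h1)
  have coord : ∀ x y v, (∀ i, p i = v → x i = y i) → φ x v = φ y v := by
    intro x y v h
    refine flp_inv (fun x => φ x v) (Finset.univ.filter fun j => p j ≠ v) ?_ x y ?_
    · intro j hj x
      exact hflip x j v (by simpa using (Finset.mem_filter.1 hj).2.symm)
    · intro j hj
      apply h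
      simpa using hj
  have coord_ne : ∀ x y i, x i ≠ y i → φ x (p i) ≠ φ y (p i) := by
    intro x y i h hc
    have h1 : φ (flp i x) (p i) = φ y (p i) := by
      apply coord
      intro j hj
      rw [hp hj, flp_self]
      cases hx : x i <;> cases hy : y i <;> simp_all
    apply flp_neq i x
    apply hinj
    ext1 u
    by_cases hu : u = p i
    · rw [hu, h1, hc]
    · exact hflip x i u hu
  let x0 : Fin d → Bool := e f
  let x1 : Fin d → Bool := fun i => !(x0 i)
  have hx0 : φ x0 = f.1.1 := by simp [φ, x0]
  have hmix : ∀ x v, φ x v = φ x0 v ∨ φ x v = φ x1 v := by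
    intro x v
    by_cases h : ∃ i, p i = v
    · obtain ⟨i, rfl⟩ := h
      by_cases hx : x i = x0 i
      · left
        exact coord _ _ _ fun j hj => by rw [hp hj, hx]
      · right
        refine coord _ _ _ fun j hj => ?_
        rw [hp hj]
        simp only [x1]
        cases hx' : x i <;> cases hy : x0 i <;> simp_all
    · left
      exact coord _ _ _ fun j hj => (h ⟨j, hj⟩).elim
  have hproper : ∀ x u w, G.Adj u w → φ x u ≠ φ x w := fun x => (e.symm x).1.2
  have hcross : ∀ u w, G.Adj u w → φ x0 u ≠ φ x1 w := by
    intro u w huw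
    let x : Fin d → Bool := fun i => if p i = w then x1 i else x0 i
    have h1 : φ x u = φ x0 u := coord _ _ _ fun i hi => by
      have : p i ≠ w := by rw [hi]; exact huw.ne
      simp [x, this]
    have h2 : φ x w = φ x1 w := coord _ _ _ fun i hi => by simp [x, hi]
    rw [← h1, ← h2]
    exact hproper x u w huw
  refine ⟨Finset.univ.image p, fun v => (φ x0 v, φ x1 v), ?_, ⟨?_, ?_⟩, ?_, ?_⟩
  · rw [Finset.card_image_of_injective _ hp]; simp
  · intro v
    simp only [Finset.mem_image, Finset.mem_univ, true_and]
    constructor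
    · intro h
      by_contra hc
      exact h (coord _ _ _ fun j hj => (hc ⟨j, hj⟩).elim)
    · rintro ⟨i, rfl⟩
      exact coord_ne _ _ _ (by simp [x1])
  · intro u w huw
    exact ⟨hproper x0 u w huw, hcross u w huw, (hcross w u huw.symm).symm, hproper x1 u w huw⟩
  · ext h
    constructor
    · intro hh
      let x : Fin d → Bool := fun i => if h.1 (p i) = φ x0 (p i) then x0 i else x1 i
      have hx : φ x = h.1 := by
        ext1 v
        by_cases hv : h.1 v = φ x0 v
        · rw [hv]
          refine coord _ _ _ fun i hi => ?_
          simp [x, hi, hv]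
        · rw [(hh v).resolve_left hv]
          refine coord _ _ _ fun i hi => ?_
          simp [x, hi, hv]
      have : (e.symm x).1 = h := Subtype.ext hx
      rw [← this]
      exact (e.symm x).2
    · intro hh v
      have h1 := hmix (e ⟨h, hh⟩) v
      simpa [φ] using h1
  · intro v
    simp [hx0]

lemma main_count {V : Type} [Fintype V] (G : SimpleGraph V) (k d : ℕ) :
    2 ^ d * numInduced (coloringGraph G k) (hypercube d) =
      ∑ S ∈ Finset.powersetCard d (Finset.univ : Finset V), Nat.card {c // Good G k (· ∈ S) c} := by
  classical
  rw [← Finset.sum_coe_sort, ← Nat.card_sigma]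
  have hL : 2 ^ d * numInduced (coloringGraph G k) (hypercube d) =
      Nat.card (Σ s : {s : Set {f : V → Fin k // ∀ u w, G.Adj u w → f u ≠ f w} //
        Nonempty (((coloringGraph G k).induce s) ≃g hypercube d)}, s.1) := by
    have := Fintype.ofFinite {s : Set {f : V → Fin k // ∀ u w, G.Adj u w → f u ≠ f w} //
        Nonempty (((coloringGraph G k).induce s) ≃g hypercube d)}
    rw [Nat.card_sigma]
    have h2 : ∀ s : {s : Set {f : V → Fin k // ∀ u w, G.Adj u w → f u ≠ f w} //
        Nonempty (((coloringGraph G k).induce s) ≃g hypercube d)}, Nat.card s.1 = 2 ^ d := by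
      rintro ⟨s, ⟨e⟩⟩
      rw [Nat.card_congr e.toEquiv]
      simp
    rw [Finset.sum_congr rfl fun s _ => h2 s]
    simp [numInduced, Nat.card_eq_fintype_card, mul_comm]
  rw [hL]
  symm
  let F : (Σ S : {S // S ∈ Finset.powersetCard d (Finset.univ : Finset V)},
      {c // Good G k (· ∈ S.1) c}) →
      (Σ s : {s : Set {f : V → Fin k // ∀ u w, G.Adj u w → f u ≠ f w} //
        Nonempty (((coloringGraph G k).induce s) ≃g hypercube d)}, s.1) := fun x =>
    ⟨⟨cube G x.2.1, cube_iso G x.1.1 (Finset.mem_powersetCard.1 x.1.2).2 x.2.1 x.2.2⟩,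
      ⟨⟨fun v => (x.2.1 v).1, proper_of_mem x.2.2 _ fun v => Or.inl rfl⟩, fun v => Or.inl rfl⟩⟩
  apply Nat.card_eq_of_bijective F
  constructor
  · rintro ⟨⟨S, hS⟩, ⟨c, hc⟩⟩ ⟨⟨S', hS'⟩, ⟨c', hc'⟩⟩ h
    have hs : cube G c = cube G c' := congrArg (fun y => y.1.1) h
    have hf : ∀ v, (c v).1 = (c' v).1 := fun v => congrArg (fun y => y.2.1.1 v) h
    have m1 : ∀ v, (c v).2 = (c' v).1 ∨ (c v).2 = (c' v).2 := by
      have : (⟨fun v => (c v).2, proper_of_mem hc _ fun v => Or.inr rfl⟩ :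
        {f : V → Fin k // ∀ u w, G.Adj u w → f u ≠ f w}) ∈ cube G c := fun v => Or.inr rfl
      rw [hs] at this
      exact this
    have m2 : ∀ v, (c' v).2 = (c v).1 ∨ (c' v).2 = (c v).2 := by
      have : (⟨fun v => (c' v).2, proper_of_mem hc' _ fun v => Or.inr rfl⟩ :
        {f : V → Fin k // ∀ u w, G.Adj u w → f u ≠ f w}) ∈ cube G c' := fun v => Or.inr rfl
      rw [← hs] at this
      exact this
    have hcc : c = c' := by
      ext1 v
      refine Prod.ext (hf v) ?_
      rcases m2 v with h2 | h2
      · rcases m1 v with h1 | h1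
        · rw [h1, h2, hf]
        · exact h1
      · exact h2.symm
    subst hcc
    have hSS : S = S' := by
      ext v
      exact (hc.1 v).symm.trans (hc'.1 v)
    subst hSS
    rfl
  · rintro ⟨⟨s, ⟨e⟩⟩, f⟩
    obtain ⟨S, c, hS, hc, hs, hf⟩ := cube_surj G s e f
    refine ⟨⟨⟨S, Finset.mem_powersetCard.2 ⟨Finset.subset_univ _, hS⟩⟩, ⟨c, hc⟩⟩, ?_⟩
    subst hs
    refine Sigma.subtype_ext rfl ?_
    apply Subtype.ext
    ext1 v
    exact hf v

end TreeHyper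

/-- The number of induced `d`-dimensional hypercubes in `C_k(T)` for a tree `T` on `n`
vertices equals `(1/2^d)·Σ_{|S|=d} k·(k-1)^{n+d-1-deg(S)}·(k-2)^{deg(S)-int(S)}·(k-3)^{int(S)}`
(stated multiplied through by `2^d`). -/
theorem tree_hypercube_count {V : Type} [Fintype V] (T : SimpleGraph V) (hT : T.IsTree)
    (n : ℕ) (hn : Fintype.card V = n) (d : ℕ) (k : ℕ) :
    2 ^ d * numInduced (coloringGraph T k) (hypercube d) =
      ∑ S ∈ Finset.powersetCard d (Finset.univ : Finset V),
        k * (k - 1) ^ (n + d - 1 - degSum T S) *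
          (k - 2) ^ (degSum T S - intEdges T S) * (k - 3) ^ (intEdges T S) := by
  rw [TreeHyper.main_count]
  refine Finset.sum_congr rfl fun S hS => ?_
  rw [TreeHyper.count_final T hT k S, (Finset.mem_powersetCard.1 hS).2, hn]
end

section
/- For a tree T, the multiset D(T) = {deg(u)+deg(v) : {u,v} pairs of distinct vertices of T} determines the degree sequence of T: if two trees T₁, T₂ (each with at least 2 vertices) satisfy D(T₁) = D(T₂) as multisets, then T₁ and T₂ have the same degree sequence. -/
/-- The multiset of degrees of the vertices of `T`. -/
noncomputable def degreeSequence {V : Type} [Fintype V] (T : SimpleGraph V) : Multiset ℕ :=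
  (Finset.univ : Finset V).val.map (fun v => (T.neighborSet v).ncard)

/-- The multiset `D(T)` of sums `deg(u) + deg(v)` over unordered pairs of distinct
vertices of `T`. -/
noncomputable def pairDegreeSums {V : Type} [Fintype V] (T : SimpleGraph V) : Multiset ℕ :=
  (Finset.powersetCard 2 (Finset.univ : Finset V)).val.map
    (fun p => ∑ v ∈ p, (T.neighborSet v).ncard)

open Polynomial in
theorem pairSum_identity {V : Type} [DecidableEq V] (d : V → ℕ) (S : Finset V) :
    (∑ u ∈ S, (X : ℤ[X]) ^ d u) ^ 2 =
      2 * ∑ p ∈ Finset.powersetCard 2 S, (X : ℤ[X]) ^ (∑ v ∈ p, d v)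
        + ∑ u ∈ S, (X : ℤ[X]) ^ (2 * d u) := by
  induction S using Finset.induction_on with
  | empty => rw [Finset.powersetCard_eq_empty.2 (by simp)]; simp
  | insert a S ha ih =>
    rw [Finset.powersetCard_succ_insert ha, Finset.sum_insert ha, Finset.sum_insert ha,
      Finset.sum_union, Finset.sum_image]
    · have h1 : ∑ p ∈ Finset.powersetCard 1 S, (X : ℤ[X]) ^ (∑ v ∈ insert a p, d v)
          = X ^ d a * ∑ u ∈ S, (X : ℤ[X]) ^ d u := by
        rw [Finset.powersetCard_one, Finset.sum_map, Finset.mul_sum]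
        refine Finset.sum_congr rfl fun u hu => ?_
        have : a ≠ u := fun h => ha (h ▸ hu)
        simp [Finset.sum_pair this, pow_add]
      rw [h1, add_sq, ih]
      ring
    · intro p hp q hq h
      have hp' := (Finset.mem_powersetCard.1 hp).1
      have hq' := (Finset.mem_powersetCard.1 hq).1
      have h' : insert a p = insert a q := h
      rw [← Finset.erase_insert (fun h => ha (hp' h)), h',
        Finset.erase_insert (fun h => ha (hq' h))]
    · rw [Finset.disjoint_left]
      intro p hp hq
      obtain ⟨q, _, rfl⟩ := Finset.mem_image.1 hq
      exact ha ((Finset.mem_powersetCard.1 hp).1 (Finset.mem_insert_self a q))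

open Polynomial in
theorem eq_of_sq_sub_expand (P Q : ℤ[X]) (h : P ^ 2 - expand ℤ 2 P = Q ^ 2 - expand ℤ 2 Q)
    (hP0 : P.coeff 0 = 0) (hQ0 : Q.coeff 0 = 0) (hP1 : 0 < P.coeff 1) (hQ1 : 0 < Q.coeff 1) :
    P = Q := by
  have h' : (P - Q) * (P + Q) = expand ℤ 2 (P - Q) := by
    rw [map_sub]; linear_combination h
  have key : ∀ k, (P - Q).coeff k = 0 := by
    intro k
    induction k using Nat.strong_induction_on with
    | _ k ih =>
      rcases Nat.eq_zero_or_pos k with rfl | hk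
      · simp [hP0, hQ0]
      have hc := congrArg (fun R => R.coeff (k + 1)) h'
      simp only [coeff_mul] at hc
      rw [Finset.sum_eq_single (k, 1)] at hc
      · rw [coeff_expand (by norm_num), coeff_add] at hc
        have hz : (P - Q).coeff k * (P.coeff 1 + Q.coeff 1 - 1) = 0 ∨
            (P - Q).coeff k * (P.coeff 1 + Q.coeff 1) = 0 := by
          split_ifs at hc with h2
          · rcases Nat.lt_or_ge ((k + 1) / 2) k with hlt | hge
            · right; rw [hc, ih _ hlt]
            · left
              have : (k + 1) / 2 = k := by omega
              rw [this] at hc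
              linear_combination hc
          · right; exact hc
        rcases hz with hz | hz <;> rcases mul_eq_zero.1 hz with hz | hz
        · exact hz
        · omega
        · exact hz
        · omega
      · rintro ⟨i, j⟩ hij hne
        rw [Finset.HasAntidiagonal.mem_antidiagonal] at hij
        simp only at hij
        rcases Nat.lt_or_ge i k with hlt | hge
        · simp [ih i hlt]
        · have hj : j = 0 := by
            by_contra hj
            apply hne
            ext <;> simp <;> omega
          subst hj
          simp [hP0, hQ0]
      · intro hn
        exact absurd (by simp) hn
  ext k
  have := key k
  rw [coeff_sub] at this
  omega

open Polynomial in
theorem tree_poly {V : Type} [Fintype V] (T : SimpleGraph V) (h : T.IsTree)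
    (hc : 2 ≤ Fintype.card V) :
    (∑ u : V, (X : ℤ[X]) ^ (T.neighborSet u).ncard).coeff 0 = 0 ∧
    0 < (∑ u : V, (X : ℤ[X]) ^ (T.neighborSet u).ncard).coeff 1 := by
  classical
  have : Nontrivial V := Fintype.one_lt_card_iff_nontrivial.1 hc
  have hd : ∀ v, (T.neighborSet v).ncard = T.degree v := by
    intro v
    rw [← T.card_neighborSet_eq_degree, Set.ncard_eq_toFinset_card', Set.toFinset_card]
  simp only [hd, finsetSum_coeff, coeff_X_pow]
  constructor
  · refine Finset.sum_eq_zero fun v _ => if_neg ?_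
    have := h.connected.preconnected.degree_pos_of_nontrivial v
    omega
  · obtain ⟨v, hv⟩ := h.exists_vert_degree_one_of_nontrivial
    refine Finset.sum_pos' (fun _ _ => by split_ifs <;> simp) ⟨v, Finset.mem_univ _, ?_⟩
    simp [hv]

open Polynomial in
theorem tree_sq {V : Type} [Fintype V] (T : SimpleGraph V) :
    (∑ u : V, (X : ℤ[X]) ^ (T.neighborSet u).ncard) ^ 2
      - expand ℤ 2 (∑ u : V, (X : ℤ[X]) ^ (T.neighborSet u).ncard)
      = 2 * ((pairDegreeSums T).map (fun n => (X : ℤ[X]) ^ n)).sum := by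
  classical
  rw [pairSum_identity (fun v => (T.neighborSet v).ncard), pairDegreeSums, Multiset.map_map]
  simp only [map_sum, map_pow, expand_X, ← pow_mul]
  rw [add_sub_cancel_right]
  rfl

/-- If two trees with at least 2 vertices have the same multiset of pair-degree-sums,
they have the same degree sequence. -/
theorem pairDegreeSums_determines_degreeSequence
    {V₁ V₂ : Type} [Fintype V₁] [Fintype V₂]
    (T₁ : SimpleGraph V₁) (T₂ : SimpleGraph V₂)
    (h₁ : T₁.IsTree) (h₂ : T₂.IsTree)
    (hc₁ : 2 ≤ Fintype.card V₁) (hc₂ : 2 ≤ Fintype.card V₂)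
    (hD : pairDegreeSums T₁ = pairDegreeSums T₂) :
    degreeSequence T₁ = degreeSequence T₂ := by
  classical
  have hPQ := eq_of_sq_sub_expand _ _ (by rw [tree_sq T₁, tree_sq T₂, hD])
    (tree_poly T₁ h₁ hc₁).1 (tree_poly T₂ h₂ hc₂).1
    (tree_poly T₁ h₁ hc₁).2 (tree_poly T₂ h₂ hc₂).2
  ext k
  have hk := congrArg (fun R => Polynomial.coeff R k) hPQ
  simp only [Polynomial.finsetSum_coeff, Polynomial.coeff_X_pow, Finset.sum_boole] at hk
  simp only [degreeSequence, Multiset.count_map]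
  exact_mod_cast hk
end
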